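/- Let X be an n×n real symmetric positive semidefinite matrix with X ≠ 0, let A = I + X, and let λ_1 ≥ λ_2 ≥ … ≥ λ_n be the eigenvalues of A listed in decreasing order (so λ_i ≥ 1 for all i and λ_1 > 1). For S ⊆ {1,…,n}, define f(S) = det(I + X_S), where X_S is the principal submatrix of X indexed by S, and write Δ_e f(S) = f(S ∪ {e}) − f(S). Let b be a natural number with b ≤ n. Then for all S ⊆ T ⊆ {1,…,n} with |T \ S| ≤ b and all e ∉ T: (λ_1 − 1)·(∏_{i=1}^{b} λ_i)·Δ_e f(S) ≥ (λ_n − 1)·Δ_e f(T). -/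

import Mathlib

open Matrix

noncomputable def vsF {n : ℕ} (B : Matrix (Fin n) (Fin n) ℝ) (S : Finset (Fin n)) : ℝ :=
  (B.submatrix (fun i : S => (i : Fin n)) (fun j : S => (j : Fin n))).det

noncomputable def vsq {n : ℕ} (B : Matrix (Fin n) (Fin n) ℝ) (z : Fin n → ℝ) : ℝ :=
  z ⬝ᵥ B *ᵥ z

def vsEquiv {n : ℕ} (S : Finset (Fin n)) (e : Fin n) (he : e ∉ S) :
    S ⊕ Unit ≃ (insert e S : Finset (Fin n)) :=
  (Equiv.optionEquivSumPUnit _).symm.trans (Finset.subtypeInsertEquivOption he).symm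

theorem vsEquiv_inl {n : ℕ} (S : Finset (Fin n)) (e : Fin n) (he : e ∉ S) (i : S) :
    ((vsEquiv S e he (Sum.inl i)) : Fin n) = i := by
  simp [vsEquiv, Finset.subtypeInsertEquivOption]

theorem vsEquiv_inr {n : ℕ} (S : Finset (Fin n)) (e : Fin n) (he : e ∉ S) (u : Unit) :
    ((vsEquiv S e he (Sum.inr u)) : Fin n) = e := by
  simp [vsEquiv, Finset.subtypeInsertEquivOption]

theorem vsF_pos {n : ℕ} {B : Matrix (Fin n) (Fin n) ℝ} (hB : B.PosDef) (S : Finset (Fin n)) :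
    0 < vsF B S :=
  (hB.submatrix Subtype.val_injective).det_pos

theorem vsF_empty {n : ℕ} (B : Matrix (Fin n) (Fin n) ℝ) : vsF B ∅ = 1 := by
  simp [vsF]

theorem vsF_univ {n : ℕ} (B : Matrix (Fin n) (Fin n) ℝ) : vsF B Finset.univ = B.det := by
  have := det_submatrix_equiv_self (Equiv.subtypeUnivEquiv (p := fun i => i ∈ (Finset.univ : Finset (Fin n))) (fun i => Finset.mem_univ i)) B
  rw [← this]
  rfl

theorem vsF_schur {n : ℕ} {B : Matrix (Fin n) (Fin n) ℝ} (hB : B.PosDef) (S : Finset (Fin n))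
    (e : Fin n) (he : e ∉ S) :
    vsF B (insert e S) = vsF B S * (B e e - ∑ i : S, B e i *
      ((B.submatrix (fun i : S => (i : Fin n)) (fun j : S => (j : Fin n)))⁻¹ *ᵥ
        (fun i : S => B i e)) i) := by
  set D := B.submatrix (fun i : S => (i : Fin n)) (fun j : S => (j : Fin n)) with hD
  have hDp : D.PosDef := hB.submatrix Subtype.val_injective
  have : Invertible D := hDp.isUnit.invertible
  have h1 : vsF B (insert e S) = (fromBlocks D (Matrix.of fun (i : S) (_ : Unit) => B i e)
      (Matrix.of fun (_ : Unit) (i : S) => B e i) (Matrix.of fun (_ _ : Unit) => B e e)).det := by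
    unfold vsF
    rw [← det_submatrix_equiv_self (vsEquiv S e he)]
    congr 1
    ext i j
    rcases i with i | i <;> rcases j with j | j <;>
      simp [vsEquiv_inl, vsEquiv_inr, hD]
  rw [h1, det_fromBlocks₁₁, invOf_eq_nonsing_inv]
  congr 1
  rw [det_unique, Matrix.mul_assoc]
  simp [Matrix.mul_apply, mulVec, dotProduct]

theorem vs_key {n : ℕ} {B : Matrix (Fin n) (Fin n) ℝ} (hB : B.PosDef) (S : Finset (Fin n))
    (e : Fin n) (he : e ∉ S) :
    ∃ y : Fin n → ℝ, y e = 1 ∧ (∀ i ∉ insert e S, y i = 0) ∧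
      vsF B (insert e S) = vsF B S * vsq B y ∧
      ∀ z : Fin n → ℝ, z e = 1 → (∀ i ∉ insert e S, z i = 0) → vsq B y ≤ vsq B z := by
  have hsch := vsF_schur hB S e he
  set D := B.submatrix (fun i : S => (i : Fin n)) (fun j : S => (j : Fin n)) with hD
  have hDp : D.PosDef := hB.submatrix Subtype.val_injective
  have hDu : IsUnit D.det := (Matrix.isUnit_iff_isUnit_det _).1 hDp.isUnit
  set x := D⁻¹ *ᵥ (fun i : S => B i e) with hx
  have hDx : D *ᵥ x = fun i : S => B i e := by
    rw [hx, mulVec_mulVec, mul_nonsing_inv _ hDu, one_mulVec]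
  let y : Fin n → ℝ := fun i => if h : i ∈ S then - x ⟨i, h⟩ else if i = e then 1 else 0
  have hye : y e = 1 := by simp [y, he]
  have hys : ∀ i ∉ insert e S, y i = 0 := by
    intro i hi
    simp only [Finset.mem_insert, not_or] at hi
    simp [y, hi.1, hi.2]
  have hsum : ∀ g : Fin n → ℝ, g ⬝ᵥ y = g e - ∑ i : S, g i * x i := by
    intro g
    rw [dotProduct, ← Finset.sum_subset (Finset.subset_univ (insert e S))
      (fun i _ hi => by rw [hys i hi, mul_zero]), Finset.sum_insert he, hye, mul_one,
      ← Finset.sum_coe_sort S, sub_eq_add_neg, ← Finset.sum_neg_distrib]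
    congr 1
    refine Finset.sum_congr rfl fun i _ => ?_
    simp [y, i.2]
  have hBy : ∀ i ∈ S, (B *ᵥ y) i = 0 := by
    intro i hi
    have h := congrFun hDx ⟨i, hi⟩
    have h2 := hsum (B i)
    simp only [mulVec, dotProduct, hD, submatrix_apply] at h h2 ⊢
    rw [h2, h, sub_self]
  have hBe : (B *ᵥ y) e = B e e - ∑ i : S, B e i * x i := hsum (B e)
  have hq : vsq B y = B e e - ∑ i : S, B e i * x i := by
    rw [vsq, dotProduct_comm, hsum, hBe, Finset.sum_eq_zero (s := Finset.univ)
      (f := fun i : S => (B *ᵥ y) i * x i), sub_zero]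
    intro i _
    rw [hBy i i.2, zero_mul]
  refine ⟨y, hye, hys, by rw [hsch, hq], ?_⟩
  intro z hze hzs
  obtain ⟨w, rfl⟩ : ∃ w, z = y + w := ⟨z - y, by simp⟩
  have hw0 : w ⬝ᵥ B *ᵥ y = 0 := by
    refine Finset.sum_eq_zero fun i _ => ?_
    by_cases hi : i ∈ S
    · rw [hBy i hi, mul_zero]
    · have : w i = 0 := by
        by_cases hie : i = e
        · subst hie
          simpa [hye] using hze
        · have := hzs i (by simp [hi, hie])
          simpa [hys i (by simp [hi, hie])] using this
      rw [this, zero_mul]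
  have hw1 : y ⬝ᵥ B *ᵥ w = 0 := by
    have ht : Bᵀ = B := by simpa using hB.isHermitian.eq
    rw [dotProduct_mulVec, ← mulVec_transpose, ht, dotProduct_comm, hw0]
  have hww : 0 ≤ w ⬝ᵥ B *ᵥ w := by simpa using hB.posSemidef.dotProduct_mulVec_nonneg w
  simp only [vsq, mulVec_add, dotProduct_add, add_dotProduct, hw0, hw1]
  linarith

/-- submodularity of log det -/
theorem vs_submod {n : ℕ} {B : Matrix (Fin n) (Fin n) ℝ} (hB : B.PosDef) {S T : Finset (Fin n)}
    (hST : S ⊆ T) (e : Fin n) (he : e ∉ T) :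
    vsF B (insert e T) * vsF B S ≤ vsF B (insert e S) * vsF B T := by
  obtain ⟨y, hy1, hy2, hy3, hy4⟩ := vs_key hB T e he
  obtain ⟨z, hz1, hz2, hz3, hz4⟩ := vs_key hB S e (fun h => he (hST h))
  have h := hy4 z hz1 (fun i hi => hz2 i (fun h => hi (Finset.insert_subset_insert e hST h)))
  rw [hy3, hz3]
  have := mul_le_mul_of_nonneg_left h (mul_pos (vsF_pos hB S) (vsF_pos hB T)).le
  linarith

/-- Fischer's inequality -/
theorem vs_fischer {n : ℕ} {B : Matrix (Fin n) (Fin n) ℝ} (hB : B.PosDef) (S R : Finset (Fin n)) :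
    Disjoint S R → vsF B (R ∪ S) ≤ vsF B R * vsF B S := by
  induction R using Finset.induction_on with
  | empty => intro _; simp [vsF_empty]
  | insert e R he ih =>
    intro hd
    rw [Finset.disjoint_insert_right] at hd
    have h1 := ih hd.2
    have h2 := vs_submod hB (Finset.subset_union_left (s₁ := R) (s₂ := S)) e
      (by simp [he, hd.1])
    rw [Finset.insert_union]
    have hR := vsF_pos hB R
    have h3 := mul_le_mul_of_nonneg_left h1 (vsF_pos hB (insert e R)).le
    refine le_of_mul_le_mul_right (a := vsF B R) ?_ hR
    linarith

theorem vs_mono {n : ℕ} {B C : Matrix (Fin n) (Fin n) ℝ} (hB : B.PosDef) (hC : C.PosDef)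
    (h : ∀ z, vsq B z ≤ vsq C z) (S : Finset (Fin n)) : vsF B S ≤ vsF C S := by
  induction S using Finset.induction_on with
  | empty => simp [vsF_empty]
  | insert e S he ih =>
    obtain ⟨y, hy1, hy2, hy3, hy4⟩ := vs_key hB S e he
    obtain ⟨z, hz1, hz2, hz3, hz4⟩ := vs_key hC S e he
    rw [hy3, hz3]
    have h0 : 0 ≤ vsq B y := by
      have := hB.posSemidef.dotProduct_mulVec_nonneg y
      simpa [vsq] using this
    exact mul_le_mul ih ((hy4 z hz1 hz2).trans (h z)) h0 (vsF_pos hC S).le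

theorem vs_step {n : ℕ} {B : Matrix (Fin n) (Fin n) ℝ} (hB : B.PosDef) {c : ℝ} (hc : 0 ≤ c)
    (h : ∀ z, c * (z ⬝ᵥ z) ≤ vsq B z) (S : Finset (Fin n)) (e : Fin n) (he : e ∉ S) :
    c * vsF B S ≤ vsF B (insert e S) := by
  obtain ⟨y, hy1, hy2, hy3, hy4⟩ := vs_key hB S e he
  have h1 : 1 ≤ y ⬝ᵥ y := by
    have := Finset.single_le_sum (f := fun i => y i * y i) (fun i _ => mul_self_nonneg (y i))
      (Finset.mem_univ e)
    simpa [hy1, dotProduct] using this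
  have h2 : c ≤ vsq B y := by nlinarith [h y]
  rw [hy3, mul_comm]
  exact mul_le_mul_of_nonneg_left h2 (vsF_pos hB S).le

theorem vs_steps {n : ℕ} {B : Matrix (Fin n) (Fin n) ℝ} (hB : B.PosDef) {c : ℝ} (hc : 0 ≤ c)
    (h : ∀ z, c * (z ⬝ᵥ z) ≤ vsq B z) (S R : Finset (Fin n)) (hd : Disjoint S R) :
    c ^ R.card * vsF B S ≤ vsF B (R ∪ S) := by
  induction R using Finset.induction_on with
  | empty => simp
  | insert e R he ih =>
    rw [Finset.disjoint_insert_right] at hd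
    have h1 := ih hd.2
    have h2 := vs_step hB hc h (R ∪ S) e (by simp [he, hd.1])
    rw [Finset.insert_union, Finset.card_insert_of_notMem he, pow_succ]
    have := mul_le_mul_of_nonneg_left h1 hc
    linarith

noncomputable def vsG {n : ℕ} (U : Matrix.unitaryGroup (Fin n) ℝ) (d : Fin n → ℝ) :
    Matrix (Fin n) (Fin n) ℝ :=
  (U : Matrix (Fin n) (Fin n) ℝ) * diagonal d * star (U : Matrix (Fin n) (Fin n) ℝ)

theorem vsq_G {n : ℕ} (U : Matrix.unitaryGroup (Fin n) ℝ) (d : Fin n → ℝ) (z : Fin n → ℝ) :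
    vsq (vsG U d) z = ∑ i, d i * ((star (U : Matrix (Fin n) (Fin n) ℝ) *ᵥ z) i) ^ 2 := by
  have h : z ᵥ* (U : Matrix (Fin n) (Fin n) ℝ) = star (U : Matrix (Fin n) (Fin n) ℝ) *ᵥ z := by
    rw [star_eq_conjTranspose, conjTranspose_eq_transpose_of_trivial, mulVec_transpose]
  rw [vsq, vsG, ← mulVec_mulVec, ← mulVec_mulVec, dotProduct_mulVec, h, dotProduct]
  refine Finset.sum_congr rfl fun i _ => ?_
  rw [mulVec_diagonal]
  ring

theorem vsq_self {n : ℕ} (U : Matrix.unitaryGroup (Fin n) ℝ) (z : Fin n → ℝ) :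
    z ⬝ᵥ z = ∑ i, ((star (U : Matrix (Fin n) (Fin n) ℝ) *ᵥ z) i) ^ 2 := by
  have h := vsq_G U (fun _ => 1) z
  have h1 : vsG U (fun _ => 1) = 1 := by
    simp [vsG]
  rw [h1] at h
  simpa [vsq] using h

theorem vsG_posDef {n : ℕ} (U : Matrix.unitaryGroup (Fin n) ℝ) (d : Fin n → ℝ)
    (hd : ∀ i, 0 < d i) : (vsG U d).PosDef := by
  have h := Matrix.PosDef.diagonal (R := ℝ) (d := d) hd
  exact (Matrix.IsUnit.posDef_star_right_conjugate_iff
    (Unitary.toUnits U).isUnit).2 h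

theorem vsG_det {n : ℕ} (U : Matrix.unitaryGroup (Fin n) ℝ) (d : Fin n → ℝ) :
    (vsG U d).det = ∏ i, d i := by
  rw [vsG, det_mul_comm, ← Matrix.mul_assoc]
  simp

theorem vs_top {n : ℕ} (U : Matrix.unitaryGroup (Fin n) ℝ) (d : Fin n → ℝ)
    (hd : ∀ i, 1 ≤ d i) (lam : Fin n → ℝ)
    (hanti : ∀ i j : Fin n, i ≤ j → lam j ≤ lam i)
    (hperm : ∃ σ : Equiv.Perm (Fin n), ∀ i, lam i = d (σ i))
    (R : Finset (Fin n)) :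
    vsF (vsG U d) R ≤ ∏ i ∈ Finset.univ.filter (fun i : Fin n => (i : ℕ) < R.card), lam i := by
  obtain ⟨σ, hσ⟩ := hperm
  rcases Nat.eq_zero_or_pos R.card with h0 | h0
  · rw [Finset.card_eq_zero] at h0
    subst h0
    simp [vsF_empty]
  have hRn : R.card ≤ n := by simpa using Finset.card_le_univ R
  let k : Fin n := ⟨R.card - 1, by omega⟩
  set c := lam k with hc
  have hc1 : 1 ≤ c := by rw [hc, hσ]; exact hd _
  have hc0 : 0 < c := by linarith
  have hp1 : (vsG U d).PosDef := vsG_posDef U d (fun i => by linarith [hd i])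
  have hp2 : (vsG U (fun i => max (d i) c)).PosDef :=
    vsG_posDef U _ (fun i => lt_max_of_lt_right hc0)
  have hm := vs_mono hp1 hp2 (fun z => by
    rw [vsq_G, vsq_G]
    exact Finset.sum_le_sum fun i _ => mul_le_mul_of_nonneg_right (le_max_left _ _) (sq_nonneg _)) R
  have hs := vs_steps hp2 hc0.le (fun z => by
    rw [vsq_G, vsq_self U, Finset.mul_sum]
    exact Finset.sum_le_sum fun i _ => mul_le_mul_of_nonneg_right (le_max_right _ _) (sq_nonneg _))
    R Rᶜ disjoint_compl_right
  rw [Finset.union_comm, Finset.union_compl, vsF_univ, vsG_det, ← Equiv.prod_comp σ] at hs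
  have hprod : ∏ i, max (d (σ i)) c =
      c ^ Rᶜ.card * ∏ i ∈ Finset.univ.filter (fun i : Fin n => (i : ℕ) < R.card), lam i := by
    rw [← Finset.prod_filter_mul_prod_filter_not Finset.univ (fun i : Fin n => (i : ℕ) < R.card),
      mul_comm]
    congr 1
    · rw [Finset.prod_congr rfl (g := fun _ => c), Finset.prod_const]
      · congr 1
        have h1 : (Finset.univ.filter (fun i : Fin n => (i : ℕ) < R.card)).card = R.card := by
          rw [Fin.card_filter_val_lt]
          omega
        rw [Finset.filter_not, ← Finset.compl_eq_univ_sdiff, Finset.card_compl,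
          Finset.card_compl, h1]
      · intro i hi
        simp only [Finset.mem_filter, Finset.mem_univ, true_and, not_lt] at hi
        rw [← hσ]
        refine max_eq_right (hanti k i ?_)
        rw [Fin.le_def]
        simp only [k]
        omega
    · refine Finset.prod_congr rfl fun i hi => ?_
      simp only [Finset.mem_filter, Finset.mem_univ, true_and] at hi
      rw [← hσ]
      refine max_eq_left (hanti i k ?_)
      rw [Fin.le_def]
      simp only [k]
      omega
  rw [hprod] at hs
  exact hm.trans (le_of_mul_le_mul_left hs (pow_pos hc0 _))


/-- Lower bound on the partition-matroid diminishing-return ratio of the video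
summarization objective `f(S) = det(I + X_S)`: if `X` is a nonzero real
symmetric positive semidefinite `n×n` matrix, `A = I + X`, and
`λ_1 ≥ … ≥ λ_n` are the eigenvalues of `A` in decreasing order, then for all
`S ⊆ T` with `|T \ S| ≤ b` and all `e ∉ T`,
`(λ_1 − 1)·(∏_{i=1}^{b} λ_i)·Δ_e f(S) ≥ (λ_n − 1)·Δ_e f(T)`. -/
theorem video_summarization_dr_bound (n b : ℕ) (hn : 1 ≤ n) (hbn : b ≤ n)
    (X : Matrix (Fin n) (Fin n) ℝ) (hX : X.PosSemidef) (hX0 : X ≠ 0)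
    (A : Matrix (Fin n) (Fin n) ℝ) (hA : A = 1 + X) (hAh : A.IsHermitian)
    -- lam is the list of eigenvalues of A in decreasing order
    (lam : Fin n → ℝ)
    (hanti : ∀ i j : Fin n, i ≤ j → lam j ≤ lam i)
    (hperm : ∃ σ : Equiv.Perm (Fin n), ∀ i, lam i = hAh.eigenvalues (σ i))
    -- f S = det (I + X_S)
    (f : Finset (Fin n) → ℝ)
    (hf : ∀ S : Finset (Fin n),
      f S = Matrix.det ((1 : Matrix S S ℝ) +
        X.submatrix (fun i : S => (i : Fin n)) (fun j : S => (j : Fin n)))) :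
    ∀ S T : Finset (Fin n), S ⊆ T → (T \ S).card ≤ b →
      ∀ e ∉ T,
        (lam ⟨0, hn⟩ - 1) * (∏ i ∈ Finset.univ.filter fun i : Fin n => (i : ℕ) < b, lam i)
            * (f (insert e S) - f S)
          ≥ (lam ⟨n - 1, by omega⟩ - 1) * (f (insert e T) - f T) := by
  have hAp : A.PosDef := hA ▸ Matrix.PosDef.one.add_posSemidef hX
  have hfF : ∀ S, f S = vsF A S := by
    intro S
    rw [hf, vsF, hA]
    congr 1
    ext i j
    rw [Matrix.add_apply, submatrix_apply, submatrix_apply, Matrix.add_apply, Matrix.one_apply,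
      Matrix.one_apply]
    simp only [Subtype.ext_iff]
  have hq1 : ∀ z : Fin n → ℝ, 1 * (z ⬝ᵥ z) ≤ vsq A z := by
    intro z
    have := hX.dotProduct_mulVec_nonneg z
    simp only [star_trivial] at this
    rw [vsq, hA, add_mulVec, one_mulVec, dotProduct_add]
    linarith
  have hAG : A = vsG hAh.eigenvectorUnitary hAh.eigenvalues := by
    have := hAh.spectral_theorem
    rw [Unitary.conjStarAlgAut_apply] at this
    exact this
  have heig : ∀ i, 1 ≤ hAh.eigenvalues i := by
    intro i
    have h := hq1 ((hAh.eigenvectorUnitary : Matrix (Fin n) (Fin n) ℝ) *ᵥ Pi.single i 1)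
    have h2 := h.trans_eq (congrArg (fun M => vsq M ((hAh.eigenvectorUnitary : Matrix (Fin n) (Fin n) ℝ) *ᵥ Pi.single i 1)) hAG)
    replace h := h2
    rw [vsq_self hAh.eigenvectorUnitary, vsq_G, mulVec_mulVec, Unitary.coe_star_mul_self, one_mulVec] at h
    simpa [Pi.single_apply] using h
  have hlam : ∀ i, 1 ≤ lam i := by
    obtain ⟨σ, hσ⟩ := hperm
    intro i
    rw [hσ]
    exact heig _
  intro S T hST hcard e he
  set P := ∏ i ∈ Finset.univ.filter (fun i : Fin n => (i : ℕ) < b), lam i with hP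
  have htop : vsF A (T \ S) ≤ P := by
    have h := vs_top hAh.eigenvectorUnitary hAh.eigenvalues heig lam hanti hperm (T \ S)
    rw [← hAG] at h
    refine h.trans ?_
    have hss : Finset.univ.filter (fun i : Fin n => (i : ℕ) < (T \ S).card) ⊆
        Finset.univ.filter (fun i : Fin n => (i : ℕ) < b) := by
      intro i hi
      simp only [Finset.mem_filter, Finset.mem_univ, true_and] at hi ⊢
      omega
    rw [hP, ← Finset.prod_sdiff hss]
    refine le_mul_of_one_le_left (Finset.prod_nonneg fun i _ => by linarith [hlam i]) ?_
    exact Finset.one_le_prod fun i _ => hlam i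
  have hfis := vs_fischer hAp S (T \ S) Finset.disjoint_sdiff
  rw [Finset.sdiff_union_of_subset hST] at hfis
  have hS := vsF_pos hAp S
  have hT := vsF_pos hAp T
  have hTS : vsF A T ≤ P * vsF A S := hfis.trans (mul_le_mul_of_nonneg_right htop hS.le)
  have hsub := vs_submod hAp hST e he
  have hmono := vs_step hAp zero_le_one hq1 S e (fun h => he (hST h))
  rw [hfF, hfF, hfF, hfF]
  have h1 : (vsF A (insert e T) - vsF A T) ≤ P * (vsF A (insert e S) - vsF A S) := by
    refine le_of_mul_le_mul_right (a := vsF A S) ?_ hS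
    have := mul_le_mul_of_nonneg_right hTS (a := vsF A (insert e S) - vsF A S) (by linarith)
    nlinarith
  have hl := hanti ⟨0, hn⟩ ⟨n - 1, by omega⟩ (by simp [Fin.le_def])
  have hl1 := hlam ⟨n - 1, by omega⟩
  have hP0 : 0 ≤ P * (vsF A (insert e S) - vsF A S) :=
    mul_nonneg (by linarith [vsF_pos hAp (T \ S)]) (by linarith)
  rw [ge_iff_le, mul_assoc]
  exact (mul_le_mul_of_nonneg_left h1 (by linarith)).trans
    (mul_le_mul_of_nonneg_right (by linarith) hP0)
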